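/- Let J be a unital Jordan algebra over a field F of characteristic different from 2 and 3, let d be a derivation with invertible values of J, and let I be a proper ideal of J with d(I) ≠ 0 (i.e., I is not contained in ker d). Then J decomposes as J = I ⊕ d(I): every element of J is the sum of an element of I and an element of d(I), and I ∩ d(I) = 0. -/

import Mathlib

/-- From Kaygorodov–Lopatin–Popov: Jordan algebras admitting derivations with invertible values. -/
theorem jordan_der_inv_values_decomp_I_dI (F : Type*) [Field F] (h2 : (2 : F) ≠ 0) (h3 : (3 : F) ≠ 0)
    (J : Type*) [NonAssocRing J] [Module F J] [SMulCommClass F J J] [IsScalarTower F J J]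
    (hcomm : ∀ x y : J, x * y = y * x)
    (hjordan : ∀ x y : J, ((x * x) * y) * x = (x * x) * (y * x))
    (d : J →ₗ[F] J) (hder : ∀ a b : J, d (a * b) = d a * b + a * d b)
    (hd0 : d ≠ 0)
    (hdinv : ∀ x : J, d x = 0 ∨ ∃ y : J, d x * y = 1 ∧ (d x * d x) * y = d x)
    (I : Submodule F J) (hideal : ∀ x ∈ I, ∀ j : J, j * x ∈ I) (hproper : I ≠ ⊤)
    (hdI : ∃ x ∈ I, d x ≠ 0) :
    (∀ j : J, ∃ a ∈ I, ∃ b ∈ I, j = a + d b) ∧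
      ∀ x ∈ I, (∃ b ∈ I, d b = x) → x = 0 := by
  constructor
  · intro j
    obtain ⟨x, hx, hdx⟩ := hdI
    obtain ⟨y, hy, -⟩ := (hdinv x).resolve_left hdx
    have hb : y * x ∈ I := hideal x hx y
    refine ⟨-(d j * (y * x)) - j * (d y * x), ?_, j * (y * x), hideal _ hb j, ?_⟩
    · exact I.sub_mem (I.neg_mem (hideal _ hb _)) (hideal _ (hideal x hx _) _)
    · have h1 : d (y * x) = d y * x + 1 := by rw [hder, hcomm y (d x), hy]
      rw [hder j, h1, mul_add, mul_one]
      abel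
  · rintro x hx ⟨b, -, rfl⟩
    rcases hdinv b with h | ⟨y, hy, -⟩
    · exact h
    · exfalso
      apply hproper
      have h1 : (1 : J) ∈ I := by
        rw [← hy, hcomm]
        exact hideal _ hx y
      rw [Submodule.eq_top_iff']
      intro j
      have := hideal _ h1 j
      rwa [mul_one] at this
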